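/- arXiv:2010.15571 — 2 statements merged into one kernel-verified Lean document; each statement's English description precedes it below -/
import Mathlib

section
/- Let d, D ≥ 1 and X = [0,1]^d. Let P ⊆ B(X,ℝ^D) be the set of all bounded functions admitting a representation, and let cl(P) denote the closure of P in B(X,ℝ^D) with respect to the uniform norm. Then: (i) cl(P) is not separable, i.e. it contains no countable dense subset; and (ii) C(X,ℝ^D) is a proper subset of cl(P). -/
open scoped ENNReal

/-- The cube `[0,1]^d` in `ℝ^d`. -/
def cube (d : ℕ) : Set (EuclideanSpace ℝ (Fin d)) :=
  {x | ∀ i, x i ∈ Set.Icc (0:ℝ) 1}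

/-- `B(X, ℝ^D)`: the Banach space of bounded functions from the cube `[0,1]^d` to `ℝ^D`
equipped with the uniform norm, realized as `lp _ ∞`. -/
noncomputable abbrev BddFun (d D : ℕ) :=
  lp (fun _ : cube d => EuclideanSpace ℝ (Fin D)) ∞

/-- The subset of `B(X,ℝ^D)` of functions admitting a representation
`f = ∑ n, f_n · 1_{K_n}` with `f_n` continuous and `K_n ⊆ X` nonempty compact. -/
def PRep (d D : ℕ) : Set (BddFun d D) :=
  {F | ∃ N : ℕ, 0 < N ∧
    ∃ (fs : Fin N → cube d → EuclideanSpace ℝ (Fin D)) (Ks : Fin N → Set (cube d)),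
      (∀ n, Continuous (fs n)) ∧
      (∀ n, (Ks n).Nonempty ∧ IsCompact (Ks n)) ∧
      ∀ x : cube d, (F : ∀ _ : cube d, EuclideanSpace ℝ (Fin D)) x
        = ∑ n, (Ks n).indicator (fs n) x}

/-- The subset of `B(X,ℝ^D)` consisting of continuous functions `C(X,ℝ^D)`. -/
def ContFun (d D : ℕ) : Set (BddFun d D) :=
  {F | Continuous fun x : cube d => (F : ∀ _ : cube d, EuclideanSpace ℝ (Fin D)) x}

/-- The point of the cube all of whose coordinates equal `t`. -/
noncomputable def cubeDiag (d : ℕ) (t : Set.Icc (0 : ℝ) 1) : cube d :=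
  ⟨WithLp.toLp 2 fun _ => (t : ℝ), fun _ => t.2⟩

theorem cubeDiag_injective {d : ℕ} (hd : 0 < d) : Function.Injective (cubeDiag d) := by
  intro s t h
  have h' : (cubeDiag d s : EuclideanSpace ℝ (Fin d)) ⟨0, hd⟩
      = (cubeDiag d t : EuclideanSpace ℝ (Fin d)) ⟨0, hd⟩ := by rw [h]
  exact Subtype.ext h'

theorem not_countable_cube {d : ℕ} (hd : 0 < d) : ¬ Countable (cube d) := by
  intro h
  have hc : Countable (Set.Icc (0 : ℝ) 1) := (cubeDiag_injective hd).countable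
  exact (Cardinal.Real.Icc_countable_iff.not.mpr (by norm_num)) (Set.countable_coe_iff.mp hc)

theorem isCompact_cube (d : ℕ) : IsCompact (cube d) := by
  have h : cube d = WithLp.toLp 2 '' Set.univ.pi fun _ : Fin d => Set.Icc (0 : ℝ) 1 := by
    ext x
    refine ⟨fun hx => ⟨x.ofLp, fun i _ => hx i, rfl⟩, ?_⟩
    rintro ⟨y, hy, rfl⟩ i
    exact hy i trivial
  rw [h]
  exact (isCompact_univ_pi fun _ => isCompact_Icc).image (PiLp.continuous_toLp 2 _)

open Classical in
theorem lp_single_mem_PRep {d D : ℕ} (x : cube d) (e : EuclideanSpace ℝ (Fin D)) :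
    (lp.single ∞ x e : BddFun d D) ∈ PRep d D := by
  refine ⟨1, one_pos, fun _ _ => e, fun _ => {x}, fun _ => continuous_const,
    fun _ => ⟨Set.singleton_nonempty x, isCompact_singleton⟩, fun y => ?_⟩
  by_cases h : y = x
  · subst h
    simp
  · simp [h]

theorem ContFun_subset_PRep {d D : ℕ} : ContFun d D ⊆ PRep d D := by
  intro F hF
  have : CompactSpace (cube d) := isCompact_iff_compactSpace.mp (isCompact_cube d)
  refine ⟨1, one_pos, fun _ => F, fun _ => Set.univ, fun _ => hF,
    fun _ => ⟨⟨cubeDiag d 0, trivial⟩, isCompact_univ⟩, fun y => ?_⟩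
  simp

/-- Distinct elements of a uniformly separated family cannot share an approximant, so a
separable set contains only countably many of them. -/
theorem TopologicalSpace.IsSeparable.countable_of_le_dist {α ι : Type*} [PseudoMetricSpace α]
    {s : Set α} (hs : IsSeparable s) {f : ι → α} (hf : ∀ i, f i ∈ s) {r : ℝ} (hr : 0 < r)
    (hsep : ∀ i j, i ≠ j → r ≤ dist (f i) (f j)) : Countable ι := by
  obtain ⟨c, hc, hsc⟩ := hs
  have hex : ∀ i, ∃ b ∈ c, dist (f i) b < r / 2 := fun i =>
    Metric.mem_closure_iff.mp (hsc (hf i)) _ (half_pos hr)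
  choose g hgc hg using hex
  have : Countable c := hc.to_subtype
  refine Function.Injective.countable (f := fun i => (⟨g i, hgc i⟩ : c)) fun i j hij => ?_
  by_contra hne
  have hgij : g i = g j := congrArg Subtype.val hij
  have h₁ := dist_triangle_right (f i) (f j) (g i)
  have h₂ := hg j
  rw [← hgij] at h₂
  linarith [hsep i j hne, hg i]

/-- The uniform closure of the set of bounded functions admitting a
representation ("the closure of the PCNNs") (i) is not separable, and
(ii) properly contains `C(X,ℝ^D)`. -/
theorem closure_PRep_not_separable_and_contains_continuous
    (d D : ℕ) (hd : 0 < d) (hD : 0 < D) :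
    ¬ TopologicalSpace.IsSeparable (closure (PRep d D)) ∧
    ContFun d D ⊂ closure (PRep d D) := by
  classical
  set e : EuclideanSpace ℝ (Fin D) := EuclideanSpace.single ⟨0, hD⟩ 1 with he
  have hnorm : ‖e‖ = 1 := by simp [he]
  have hmem (x : cube d) : (lp.single ∞ x e : BddFun d D) ∈ closure (PRep d D) :=
    subset_closure (lp_single_mem_PRep x e)
  refine ⟨fun hs => not_countable_cube hd ?_, ContFun_subset_PRep.trans subset_closure,
    fun hsub => not_countable_cube hd ?_⟩
  · refine hs.countable_of_le_dist hmem one_pos fun x y hxy => ?_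
    rw [dist_eq_norm]
    have h := lp.norm_apply_le_norm ENNReal.top_ne_zero
      (lp.single ∞ x e - lp.single ∞ y e : BddFun d D) x
    rwa [lp.coeFn_sub, Pi.sub_apply, lp.single_apply_self, lp.single_apply_ne _ _ _ hxy,
      sub_zero, hnorm] at h
  · have hopen (x : cube d) : IsOpen ({x} : Set (cube d)) := by
      have hcont : Continuous fun y => (lp.single ∞ x e : BddFun d D) y := hsub (hmem x)
      have hset : ({x} : Set (cube d))
          = (fun y => (lp.single ∞ x e : BddFun d D) y) ⁻¹' {0}ᶜ := by
        ext y
        by_cases h : y = x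
        · subst h
          simp [he]
        · simp [h]
      rw [hset]
      exact isOpen_compl_singleton.preimage hcont
    have : DiscreteTopology (cube d) := discreteTopology_iff_isOpen_singleton.mpr hopen
    exact TopologicalSpace.separableSpace_iff_countable.mp inferInstance
end

section
/- Let X ⊆ ℝ^d be nonempty and compact and let f ∈ B(X,ℝ^D) have finite minimal representation number N := N(f). Let D₁ be a dense subset of C(X,ℝ^D) and D₂ a dense subset of C(X,ℝ^N), both with the uniform norm. Then for every ε > 0 there exist f̂_1,…,f̂_N ∈ D₁, ĉ ∈ D₂ and γ > 0 such that, setting K̂_n := {x ∈ X : ĉ(x)_n ≤ γ} for n = 1,…,N, each K̂_n is a nonempty compact subset of X and D_PC(f | ∑_{n=1}^{N} f̂_n·1_{K̂_n}) < ε. -/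
open scoped ENNReal

/-- `IsRep X f fs Ks` : `((fs n, Ks n))_{n=1}^N` is a representation of `f` on `X`,
with `N` a positive integer, the `fs n` continuous on `X`, the `Ks n` nonempty compact
subsets of `X`, and `f = ∑ n, fs n · 1_{Ks n}` on `X`. -/
def IsRep {d D : ℕ} (X : Set (EuclideanSpace ℝ (Fin d)))
    (f : EuclideanSpace ℝ (Fin d) → EuclideanSpace ℝ (Fin D)) {N : ℕ}
    (fs : Fin N → EuclideanSpace ℝ (Fin d) → EuclideanSpace ℝ (Fin D))
    (Ks : Fin N → Set (EuclideanSpace ℝ (Fin d))) : Prop :=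
  0 < N ∧
    (∀ n, ContinuousOn (fs n) X) ∧
    (∀ n, (Ks n).Nonempty ∧ IsCompact (Ks n) ∧ Ks n ⊆ X) ∧
    ∀ x ∈ X, f x = ∑ n, (Ks n).indicator (fs n) x

/-- The piecewise divergence `D_PC(f|g)` (with minimal representation number `Nf` of `f`
given as a parameter): the infimum over all representations `F` of `f` and `G` of `g` of
`d_Step1(F,G) + |#F − Nf| + |#G − Nf|`, where `d_Step1` is the maximum over parts of the
maximum of the uniform distance between subpatterns and the Hausdorff distance between
parts, and is `∞` when `#F ≠ #G`. -/
noncomputable def DPC {d D : ℕ} (X : Set (EuclideanSpace ℝ (Fin d))) (Nf : ℕ)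
    (f g : EuclideanSpace ℝ (Fin d) → EuclideanSpace ℝ (Fin D)) : ℝ≥0∞ :=
  ⨅ (N : ℕ) (N' : ℕ)
    (fs : Fin N → EuclideanSpace ℝ (Fin d) → EuclideanSpace ℝ (Fin D))
    (Ks : Fin N → Set (EuclideanSpace ℝ (Fin d)))
    (gs : Fin N' → EuclideanSpace ℝ (Fin d) → EuclideanSpace ℝ (Fin D))
    (Ls : Fin N' → Set (EuclideanSpace ℝ (Fin d)))
    (_ : IsRep X f fs Ks) (_ : IsRep X g gs Ls),
    (if h : N = N' then
        ⨆ n : Fin N,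
          max (⨆ x ∈ X, edist (fs n x) (gs (Fin.cast h n) x))
            (EMetric.hausdorffEdist (Ks n) (Ls (Fin.cast h n)))
      else ⊤)
      + (((N : ℤ) - (Nf : ℤ)).natAbs : ℝ≥0∞)
      + (((N' : ℤ) - (Nf : ℤ)).natAbs : ℝ≥0∞)

/-- Representations of `f` and `g` with `N` parts whose subpatterns and parts are all `r`-close
bound the piecewise divergence by `r`. -/
theorem DPC_le_of_isRep {d D N : ℕ} {X : Set (EuclideanSpace ℝ (Fin d))}
    {f g : EuclideanSpace ℝ (Fin d) → EuclideanSpace ℝ (Fin D)}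
    {fs gs : Fin N → EuclideanSpace ℝ (Fin d) → EuclideanSpace ℝ (Fin D)}
    {Ks Ls : Fin N → Set (EuclideanSpace ℝ (Fin d))} {r : ℝ≥0∞}
    (hf : IsRep X f fs Ks) (hg : IsRep X g gs Ls)
    (hfg : ∀ n, ∀ x ∈ X, edist (fs n x) (gs n x) ≤ r)
    (hKL : ∀ n, Metric.hausdorffEDist (Ks n) (Ls n) ≤ r) : DPC X N f g ≤ r := by
  unfold DPC
  refine iInf_le_of_le N <| iInf_le_of_le N <| iInf_le_of_le fs <| iInf_le_of_le Ks <|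
    iInf_le_of_le gs <| iInf_le_of_le Ls <| iInf_le_of_le hf <| iInf_le_of_le hg ?_
  simpa using fun n => ⟨hfg n, hKL n⟩

section Sublevel

variable {α : Type*} [PseudoMetricSpace α] {X K : Set α} {c : α → ℝ} {δ : ℝ}

theorem subset_sublevel_of_abs_sub_infDist_lt (hKX : K ⊆ X)
    (hc : ∀ x ∈ X, |c x - Metric.infDist x K| < δ) : K ⊆ {x ∈ X | c x ≤ δ} := by
  intro x hx
  have h := hc x (hKX hx)
  rw [Metric.infDist_zero_of_mem hx, sub_zero] at h
  exact ⟨hKX hx, (abs_lt.1 h).2.le⟩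

theorem hausdorffEDist_sublevel_le_of_abs_sub_infDist_lt (hK : K.Nonempty) (hKX : K ⊆ X)
    (hc : ∀ x ∈ X, |c x - Metric.infDist x K| < δ) :
    Metric.hausdorffEDist K {x ∈ X | c x ≤ δ} ≤ ENNReal.ofReal (2 * δ) := by
  refine Metric.hausdorffEDist_le_of_mem_edist
    (fun x hx => ⟨x, subset_sublevel_of_abs_sub_infDist_lt hKX hc hx, by simp⟩) ?_
  rintro x ⟨hxX, hxc⟩
  have h := (abs_lt.1 (hc x hxX)).1
  obtain ⟨y, hy, hxy⟩ := (Metric.infDist_lt_iff hK).1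
    (show Metric.infDist x K < 2 * δ by linarith)
  exact ⟨y, hy, edist_dist x y ▸ ENNReal.ofReal_le_ofReal hxy.le⟩

theorem IsCompact.sublevel (hX : IsCompact X) (hc : ContinuousOn c X) (a : ℝ) :
    IsCompact {x ∈ X | c x ≤ a} := by
  obtain ⟨u, hu, h⟩ := continuousOn_iff_isClosed.1 hc (Set.Iic a) isClosed_Iic
  have : {x ∈ X | c x ≤ a} = X ∩ u := by
    rw [Set.inter_comm, ← h, Set.inter_comm]
    rfl
  exact this ▸ hX.inter_right hu

end Sublevel

/-- PCNNs are universal approximators of piecewise continuous functions.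
Let `f` have minimal representation number `Nf` on the nonempty compact `X = [0,1]^d`-like
set, let `D₁` be uniformly dense in `C(X,ℝ^D)` and `D₂` uniformly dense in `C(X,ℝ^{Nf})`.
Then for every `ε > 0` there are subpatterns `fhat n ∈ D₁`, a classifier `chat ∈ D₂`, and a
threshold `γ > 0` such that the deep zero-sets `Khat n = {x ∈ X : chat(x)_n ≤ γ}` are
nonempty compact subsets of `X` and `D_PC(f | ∑ n, fhat n · 1_{Khat n}) < ε`. -/
theorem PCNN_universal_piecewise_continuous
    {d D : ℕ} (X : Set (EuclideanSpace ℝ (Fin d))) (hXne : X.Nonempty) (hX : IsCompact X)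
    (f : EuclideanSpace ℝ (Fin d) → EuclideanSpace ℝ (Fin D)) (Nf : ℕ)
    (fs : Fin Nf → EuclideanSpace ℝ (Fin d) → EuclideanSpace ℝ (Fin D))
    (Ks : Fin Nf → Set (EuclideanSpace ℝ (Fin d)))
    (hrep : IsRep X f fs Ks)
    (hmin : ∀ (M : ℕ)
      (gs : Fin M → EuclideanSpace ℝ (Fin d) → EuclideanSpace ℝ (Fin D))
      (Ls : Fin M → Set (EuclideanSpace ℝ (Fin d))), IsRep X f gs Ls → Nf ≤ M)
    (D₁ : Set (EuclideanSpace ℝ (Fin d) → EuclideanSpace ℝ (Fin D)))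
    (hD₁c : ∀ g ∈ D₁, ContinuousOn g X)
    (hD₁dense : ∀ g : EuclideanSpace ℝ (Fin d) → EuclideanSpace ℝ (Fin D),
      ContinuousOn g X → ∀ δ : ℝ, 0 < δ → ∃ h ∈ D₁, ∀ x ∈ X, ‖h x - g x‖ < δ)
    (D₂ : Set (EuclideanSpace ℝ (Fin d) → EuclideanSpace ℝ (Fin Nf)))
    (hD₂c : ∀ c ∈ D₂, ContinuousOn c X)
    (hD₂dense : ∀ g : EuclideanSpace ℝ (Fin d) → EuclideanSpace ℝ (Fin Nf),
      ContinuousOn g X → ∀ δ : ℝ, 0 < δ → ∃ c ∈ D₂, ∀ x ∈ X, ‖c x - g x‖ < δ)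
    (ε : ℝ) (hε : 0 < ε) :
    ∃ (fhat : Fin Nf → EuclideanSpace ℝ (Fin d) → EuclideanSpace ℝ (Fin D))
      (chat : EuclideanSpace ℝ (Fin d) → EuclideanSpace ℝ (Fin Nf)) (γ : ℝ),
      (∀ n, fhat n ∈ D₁) ∧ chat ∈ D₂ ∧ 0 < γ ∧
      (∀ n : Fin Nf,
        ({x ∈ X | chat x n ≤ γ}).Nonempty ∧ IsCompact {x ∈ X | chat x n ≤ γ}) ∧
      DPC X Nf f (fun x => ∑ n, ({x ∈ X | chat x n ≤ γ}).indicator (fhat n) x)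
        < ENNReal.ofReal ε := by
  obtain ⟨hN, hfs, hKs, -⟩ := id hrep
  have hδ : 0 < ε / 4 := by positivity
  choose fhat hfhat hfhat_lt using fun n => hD₁dense (fs n) (hfs n) (ε / 4) hδ
  obtain ⟨chat, hchat, hchat_lt⟩ := hD₂dense
    (fun x => WithLp.toLp 2 fun n => Metric.infDist x (Ks n))
    (Continuous.continuousOn ((PiLp.continuous_toLp 2 _).comp
      (continuous_pi fun n => Metric.continuous_infDist_pt (Ks n)))) (ε / 4) hδ
  have hc : ∀ n, ∀ x ∈ X, |chat x n - Metric.infDist x (Ks n)| < ε / 4 := fun n x hx =>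
    (PiLp.norm_apply_le (chat x - WithLp.toLp 2 fun n => Metric.infDist x (Ks n)) n).trans_lt
      (hchat_lt x hx)
  have hne : ∀ n, ({x ∈ X | chat x n ≤ ε / 4}).Nonempty := fun n =>
    (hKs n).1.mono (subset_sublevel_of_abs_sub_infDist_lt (hKs n).2.2 (hc n))
  have hcpt : ∀ n, IsCompact {x ∈ X | chat x n ≤ ε / 4} := fun n =>
    hX.sublevel ((PiLp.continuous_apply 2 _ n).comp_continuousOn (hD₂c chat hchat)) _
  refine ⟨fhat, chat, ε / 4, hfhat, hchat, hδ, fun n => ⟨hne n, hcpt n⟩, ?_⟩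
  refine lt_of_le_of_lt (b := ENNReal.ofReal (2 * (ε / 4))) ?_
    ((ENNReal.ofReal_lt_ofReal_iff hε).2 (by linarith))
  refine DPC_le_of_isRep hrep
    ⟨hN, fun n => hD₁c _ (hfhat n), fun n => ⟨hne n, hcpt n, Set.sep_subset _ _⟩,
      fun x _ => rfl⟩ (fun n x hx => ?_)
    (fun n => hausdorffEDist_sublevel_le_of_abs_sub_infDist_lt (hKs n).1 (hKs n).2.2 (hc n))
  rw [edist_dist, dist_comm, dist_eq_norm]
  exact ENNReal.ofReal_le_ofReal (by linarith [hfhat_lt n x hx])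
end
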